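/- Let p and q be coprime positive integers. On S = {(x,y) ∈ ℂ × ℂ : (x,y) ≠ (0,0)} define the equivalence relation (x,y) ∼ (x',y') if and only if there exists t ∈ ℂ, t ≠ 0, with x' = t^p·x and y' = t^q·y, and give the quotient ℙ¹_{(p,q)} = S/∼ the quotient topology. Then there is a homeomorphism h from ℙ¹_{(p,q)} to the complex projective line ℙ(ℂ²) (the Projectivization of ℂ × ℂ over ℂ, i.e. the quotient of S by the scalar action of ℂ∖{0}, with its quotient topology) such that h sends the class of (x,y) to the projective class of (x^q, y^p). -/

import Mathlib

open scoped LinearAlgebra.Projectivization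

/-- The `(p,q)`-weighted equivalence on `ℂ² ∖ {0}`: `(x,y) ∼ (t^p·x, t^q·y)` for
`t ∈ ℂ*`. -/
def wpRel (p q : ℕ) (v w : {v : ℂ × ℂ // v ≠ 0}) : Prop :=
  ∃ t : ℂ, t ≠ 0 ∧ (w : ℂ × ℂ).1 = t ^ p * (v : ℂ × ℂ).1 ∧
    (w : ℂ × ℂ).2 = t ^ q * (v : ℂ × ℂ).2

/-- The weighted projective line `ℙ¹_{(p,q)}`, with the quotient topology. -/
def WProjLine (p q : ℕ) : Type :=
  Quot (wpRel p q)

noncomputable instance (p q : ℕ) : TopologicalSpace (WProjLine p q) :=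
  inferInstanceAs (TopologicalSpace (Quot _))

noncomputable instance : TopologicalSpace (Projectivization ℂ (ℂ × ℂ)) :=
  inferInstanceAs (TopologicalSpace (Quotient _))

lemma pow_pair_ne_zero {p q : ℕ} (hp : 0 < p) (hq : 0 < q) {v : ℂ × ℂ} (hv : v ≠ 0) :
    ((v.1 ^ q, v.2 ^ p) : ℂ × ℂ) ≠ 0 := by
  intro h
  apply hv
  rw [Prod.ext_iff] at h ⊢
  simp only [Prod.fst_zero, Prod.snd_zero] at h ⊢
  exact ⟨(pow_eq_zero_iff hq.ne').mp h.1, (pow_eq_zero_iff hp.ne').mp h.2⟩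

lemma isProperMap_pow {n : ℕ} (hn : 0 < n) : IsProperMap fun z : ℂ ↦ z ^ n := by
  refine isProperMap_iff_tendsto_cocompact.2 ⟨by fun_prop, ?_⟩
  rw [← Metric.cobounded_eq_cocompact, ← comap_norm_atTop, Filter.tendsto_comap_iff]
  have h : (norm ∘ fun z : ℂ ↦ z ^ n) = (fun r : ℝ ↦ r ^ n) ∘ norm := by
    ext z
    simp
  rw [h]
  exact (Filter.tendsto_pow_atTop hn.ne').comp Filter.tendsto_comap

lemma exists_rootOfUnity_mul_eq {n : ℕ} (hn : 0 < n) {x y : ℂ} (h : x ^ n = y ^ n) :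
    ∃ ζ : ℂ, ζ ^ n = 1 ∧ x = ζ * y := by
  by_cases hy : y = 0
  · refine ⟨1, one_pow n, ?_⟩
    rw [hy, zero_pow hn.ne', pow_eq_zero_iff hn.ne'] at h
    simp [h, hy]
  · refine ⟨x / y, ?_, (div_mul_cancel₀ x hy).symm⟩
    rw [div_pow, h, div_self (pow_ne_zero n hy)]

lemma exists_pow_eq_rootsOfUnity {p q : ℕ} (hp : 0 < p) (hq : 0 < q) (hpq : Nat.gcd p q = 1)
    {ζ η : ℂ} (hζ : ζ ^ q = 1) (hη : η ^ p = 1) :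
    ∃ ε : ℂ, ε ≠ 0 ∧ ε ^ p = ζ ∧ ε ^ q = η := by
  have hζ₀ : ζ ≠ 0 := by
    rintro rfl
    simp [hq.ne'] at hζ
  have hη₀ : η ≠ 0 := by
    rintro rfl
    simp [hp.ne'] at hη
  have bezout : (p : ℤ) * p.gcdA q + q * p.gcdB q = 1 := by
    rw [← Nat.gcd_eq_gcd_ab, hpq, Nat.cast_one]
  generalize p.gcdA q = u at bezout
  generalize p.gcdB q = v at bezout
  refine ⟨ζ ^ u * η ^ v, mul_ne_zero (zpow_ne_zero u hζ₀) (zpow_ne_zero v hη₀), ?_, ?_⟩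
  · have h : u * (p : ℤ) = 1 - q * v := by linarith
    rw [mul_pow, ← zpow_natCast, ← zpow_natCast, ← zpow_mul, ← zpow_mul, h, mul_comm v,
      zpow_mul η, zpow_natCast, hη, zpow_sub₀ hζ₀, zpow_mul, zpow_natCast, hζ]
    simp
  · have h : v * (q : ℤ) = 1 - p * u := by linarith
    rw [mul_pow, ← zpow_natCast, ← zpow_natCast, ← zpow_mul, ← zpow_mul, h, mul_comm u,
      zpow_mul ζ, zpow_natCast, hζ, zpow_sub₀ hη₀, zpow_mul, zpow_natCast, hη]
    simp

/-- The map `(x, y) ↦ (x^q, y^p)` of `ℂ² ∖ {0}` to itself. -/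
def powPair {p q : ℕ} (hp : 0 < p) (hq : 0 < q) (v : {v : ℂ × ℂ // v ≠ 0}) :
    {v : ℂ × ℂ // v ≠ 0} :=
  ⟨((v : ℂ × ℂ).1 ^ q, (v : ℂ × ℂ).2 ^ p), pow_pair_ne_zero hp hq v.2⟩

lemma continuous_powPair {p q : ℕ} (hp : 0 < p) (hq : 0 < q) : Continuous (powPair hp hq) := by
  unfold powPair
  fun_prop

lemma surjective_powPair {p q : ℕ} (hp : 0 < p) (hq : 0 < q) :
    Function.Surjective (powPair hp hq) := by
  rintro ⟨⟨x, y⟩, hxy⟩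
  obtain ⟨a, rfl⟩ := IsAlgClosed.exists_pow_nat_eq x hq
  obtain ⟨b, rfl⟩ := IsAlgClosed.exists_pow_nat_eq y hp
  refine ⟨⟨(a, b), ?_⟩, rfl⟩
  rintro h
  obtain ⟨rfl, rfl⟩ := Prod.mk_eq_zero.1 h
  simp [hp.ne', hq.ne'] at hxy

lemma isClosedMap_powPair {p q : ℕ} (hp : 0 < p) (hq : 0 < q) :
    IsClosedMap (powPair hp hq) := by
  intro s hs
  obtain ⟨t, ht, rfl⟩ := isClosed_induced_iff.1 hs
  have hprod := (isProperMap_pow hq).prodMap (isProperMap_pow hp)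
  refine isClosed_induced_iff.2 ⟨_, hprod.isClosedMap t ht, ?_⟩
  ext ⟨w, hw⟩
  constructor
  · rintro ⟨v, hv, rfl⟩
    refine ⟨⟨v, ?_⟩, hv, rfl⟩
    rintro rfl
    simp [Prod.map, hp.ne', hq.ne'] at hw
  · rintro ⟨v, hv, h⟩
    exact ⟨v, hv, congrArg Subtype.val h⟩

lemma isQuotientMap_powPair {p q : ℕ} (hp : 0 < p) (hq : 0 < q) :
    Topology.IsQuotientMap (powPair hp hq) :=
  (isClosedMap_powPair hp hq).isQuotientMap (continuous_powPair hp hq) (surjective_powPair hp hq)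

lemma mk'_powPair_eq_of_wpRel {p q : ℕ} (hp : 0 < p) (hq : 0 < q)
    {v w : {v : ℂ × ℂ // v ≠ 0}} (h : wpRel p q v w) :
    Projectivization.mk' ℂ (powPair hp hq v) = Projectivization.mk' ℂ (powPair hp hq w) := by
  obtain ⟨t, -, h₁, h₂⟩ := h
  refine Eq.symm ((Projectivization.mk_eq_mk_iff' ℂ _ _ _ _).2 ⟨t ^ (p * q), ?_⟩)
  ext
  · simp only [Prod.smul_fst, smul_eq_mul, h₁]
    ring
  · simp only [Prod.smul_snd, smul_eq_mul, h₂]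
    ring

lemma wpRel_of_mk'_powPair_eq {p q : ℕ} (hp : 0 < p) (hq : 0 < q) (hpq : Nat.gcd p q = 1)
    {v w : {v : ℂ × ℂ // v ≠ 0}}
    (h : Projectivization.mk' ℂ (powPair hp hq v) = Projectivization.mk' ℂ (powPair hp hq w)) :
    wpRel p q v w := by
  obtain ⟨a, ha⟩ := (Projectivization.mk_eq_mk_iff ℂ _ _ _ _).1 h.symm
  obtain ⟨s, hs⟩ := IsAlgClosed.exists_pow_nat_eq (a : ℂ) (Nat.mul_pos hp hq)
  have hs₀ : s ≠ 0 := by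
    rintro rfl
    exact a.ne_zero (by rw [← hs, zero_pow (Nat.mul_pos hp hq).ne'])
  have h₁ : (w : ℂ × ℂ).1 ^ q = (s ^ p * (v : ℂ × ℂ).1) ^ q := by
    rw [mul_pow, ← pow_mul, hs]
    exact (congrArg Prod.fst ha).symm
  have h₂ : (w : ℂ × ℂ).2 ^ p = (s ^ q * (v : ℂ × ℂ).2) ^ p := by
    rw [mul_pow, ← pow_mul, mul_comm q p, hs]
    exact (congrArg Prod.snd ha).symm
  obtain ⟨ζ, hζ, hw₁⟩ := exists_rootOfUnity_mul_eq hq h₁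
  obtain ⟨η, hη, hw₂⟩ := exists_rootOfUnity_mul_eq hp h₂
  obtain ⟨ε, hε, rfl, rfl⟩ := exists_pow_eq_rootsOfUnity hp hq hpq hζ hη
  refine ⟨ε * s, mul_ne_zero hε hs₀, ?_, ?_⟩
  · rw [hw₁, mul_pow, mul_assoc]
  · rw [hw₂, mul_pow, mul_assoc]

/-- The map `[x : y]_{(p,q)} ↦ [x^q : y^p]`. -/
noncomputable def WProjLine.toProjLine {p q : ℕ} (hp : 0 < p) (hq : 0 < q) :
    WProjLine p q → Projectivization ℂ (ℂ × ℂ) :=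
  Quot.lift (fun v ↦ Projectivization.mk' ℂ (powPair hp hq v))
    fun _ _ ↦ mk'_powPair_eq_of_wpRel hp hq

lemma WProjLine.injective_toProjLine {p q : ℕ} (hp : 0 < p) (hq : 0 < q)
    (hpq : Nat.gcd p q = 1) : Function.Injective (toProjLine hp hq) := by
  rintro ⟨v⟩ ⟨w⟩ h
  exact Quot.sound (wpRel_of_mk'_powPair_eq hp hq hpq h)

lemma WProjLine.isQuotientMap_toProjLine {p q : ℕ} (hp : 0 < p) (hq : 0 < q) :
    Topology.IsQuotientMap (toProjLine hp hq) := by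
  have hmk : Topology.IsQuotientMap (Projectivization.mk' ℂ (V := ℂ × ℂ)) :=
    isQuotientMap_quot_mk
  exact .of_comp_isQuotientMap (f := (Quot.mk (wpRel p q) : _ → WProjLine p q))
    isQuotientMap_quot_mk (hmk.comp (isQuotientMap_powPair hp hq))

/-- For coprime positive integers `p, q`, the weighted projective line
`ℙ¹_{(p,q)}` is homeomorphic to the projective line `ℙ(ℂ²)` via
`[x : y]_{(p,q)} ↦ [x^q : y^p]`. -/
theorem wProjLine_homeomorph_projLine (p q : ℕ) (hp : 0 < p) (hq : 0 < q)
    (hpq : Nat.gcd p q = 1) :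
    ∃ h : WProjLine p q ≃ₜ Projectivization ℂ (ℂ × ℂ),
      ∀ (v : ℂ × ℂ) (hv : v ≠ 0),
        h (Quot.mk (wpRel p q) ⟨v, hv⟩) =
          Projectivization.mk ℂ (v.1 ^ q, v.2 ^ p) (pow_pair_ne_zero hp hq hv) := by
  have h := isHomeomorph_iff_isQuotientMap_injective.2
    ⟨WProjLine.isQuotientMap_toProjLine hp hq, WProjLine.injective_toProjLine hp hq hpq⟩
  exact ⟨h.homeomorph, fun _ _ ↦ rfl⟩
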